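/- arXiv:2205.05044 — 2 statements merged into one kernel-verified Lean document; each statement's English description precedes it below -/
import Mathlib

section
/- Let G be a graph with an m-sparse spanning subgraph F, and let e be an edge of G not in F whose endpoints lie in different m-tree-connected components of F. Then F + e is still m-sparse. -/
open SimpleGraph

def IsTreeConn {V : Type*} (m : ℕ) (G : SimpleGraph V) : Prop :=
  ∃ T : Fin m → SimpleGraph V, (∀ i, T i ≤ G) ∧ (∀ i, (T i).IsTree) ∧
    ∀ i j, i ≠ j → Disjoint (T i).edgeSet (T j).edgeSet

noncomputable def eIn {V : Type*} (G : SimpleGraph V) (S : Set V) : ℕ :=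
  {e ∈ G.edgeSet | ∀ v ∈ e, v ∈ S}.ncard

def IsSparse {V : Type*} (m : ℕ) (G : SimpleGraph V) : Prop :=
  ∀ S : Set V, S.Nonempty → (eIn G S : ℤ) ≤ m * S.ncard - m

def mComp {V : Type*} (m : ℕ) (G : SimpleGraph V) (v : V) : Set V :=
  ⋃₀ {X : Set V | v ∈ X ∧ IsTreeConn m (G.induce X)}

noncomputable def crossE {V : Type*} (m : ℕ) (G : SimpleGraph V) : ℕ :=
  {e ∈ G.edgeSet | ∃ u ∈ e, ∃ w ∈ e, mComp m G u ≠ mComp m G w}.ncard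

noncomputable def Omega {V : Type*} (m : ℕ) (G : SimpleGraph V) : ℤ :=
  m * (Set.range (mComp m G)).ncard - crossE m G

/-- The graph formed by the edges in `E` that receive colour `i` under the colouring `c`. -/
def colorClass {V ι : Type*} (E : Set (Sym2 V)) (c : Sym2 V → ι) (i : ι) : SimpleGraph V :=
  fromEdgeSet {e ∈ E | c e = i}

/-- A colouring of `E` with the edge `f` left uncoloured, in which every colour class is a
forest. -/
def IsForestColoring {V ι : Type*} (E : Set (Sym2 V)) (p : (Sym2 V → ι) × Sym2 V) : Prop :=
  p.2 ∈ E ∧ ∀ i, (colorClass (E \ {p.2}) p.1 i).IsAcyclic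

open Classical in
/-- Colour the uncoloured edge and uncolour another one in exchange. -/
def ExchangeStep {V ι : Type*} (E : Set (Sym2 V)) (p q : (Sym2 V → ι) × Sym2 V) : Prop :=
  IsForestColoring E q ∧ q.1 = p.1 ∘ Equiv.swap p.2 q.2

/-- The edges that can be made uncoloured by a sequence of exchanges. -/
def exchangeable {V ι : Type*} (E : Set (Sym2 V)) (p : (Sym2 V → ι) × Sym2 V) : Set (Sym2 V) :=
  {g | ∃ c, Relation.ReflTransGen (ExchangeStep E) p (c, g)}

lemma SimpleGraph.IsAcyclic.not_reachable_deleteEdges {V : Type*} {T : SimpleGraph V}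
    (hT : T.IsAcyclic) {u v : V} {p : T.Walk u v} (hp : p.IsPath) {g : Sym2 V}
    (hg : g ∈ p.edges) : ¬ (T.deleteEdges {g}).Reachable u v := by
  intro h
  obtain ⟨q, hq⟩ := h.exists_isPath
  have hle : T.deleteEdges {g} ≤ T := deleteEdges_le _
  have heq := congrArg Subtype.val
    ((hT.subsingleton_path u v).elim ⟨p, hp⟩ ⟨q.mapLe hle, hq.mapLe hle⟩)
  simp only at heq
  rw [heq] at hg
  simp only [Walk.edges_mapLe_eq_edges] at hg
  have := q.edges_subset_edgeSet hg
  simp at this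

lemma SimpleGraph.reachable_of_le_reachable {V : Type*} {H K : SimpleGraph V}
    (h : ∀ a b, H.Adj a b → K.Reachable a b) {u v : V} (huv : H.Reachable u v) :
    K.Reachable u v := by
  obtain ⟨p⟩ := huv
  induction p with
  | nil => exact .rfl
  | cons hadj _ ih => exact (h _ _ hadj).trans ih

section Exchange

variable {V ι : Type*} {E : Set (Sym2 V)}

/-- If the uncoloured edge joins two components of some colour class, it can be coloured. -/
lemma exists_forest_coloring_of_not_reachable {c : Sym2 V → ι} {u v : V} {i : ι}
    (h : IsForestColoring E (c, s(u, v)))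
    (hr : ¬ (colorClass (E \ {s(u, v)}) c i).Reachable u v) :
    ∃ c' : Sym2 V → ι, ∀ j, (colorClass E c' j).IsAcyclic := by
  classical
  refine ⟨Function.update c s(u, v) i, fun j => ?_⟩
  by_cases hj : j = i
  · subst hj
    refine IsAcyclic.anti ?_ ((isAcyclic_add_edge_iff_of_not_reachable u v hr).2 (h.2 j))
    intro a b hab
    simp only [colorClass, fromEdgeSet_adj, Set.mem_ofPred_eq, sup_adj, edge, Set.mem_sdiff,
      Set.mem_singleton_iff, Function.update_apply] at hab ⊢
    grind
  · refine IsAcyclic.anti ?_ (h.2 j)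
    intro a b hab
    simp only [colorClass, fromEdgeSet_adj, Set.mem_ofPred_eq, Set.mem_sdiff,
      Set.mem_singleton_iff, Function.update_apply] at hab ⊢
    grind

/-- The uncoloured edge can be exchanged for any edge on the path joining its ends in a colour
class. -/
lemma exchangeStep_of_mem_edges {c : Sym2 V → ι} {u v : V} {i : ι}
    (h : IsForestColoring E (c, s(u, v)))
    {p : (colorClass (E \ {s(u, v)}) c i).Walk u v} (hp : p.IsPath) {g : Sym2 V}
    (hg : g ∈ p.edges) :
    ∃ c', ExchangeStep E (c, s(u, v)) (c', g) := by
  classical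
  have hgT := p.edges_subset_edgeSet hg
  have hnr := (h.2 i).not_reachable_deleteEdges hp hg
  simp only [colorClass, edgeSet_fromEdgeSet, Set.mem_sdiff, Set.mem_ofPred_eq,
    Set.mem_singleton_iff] at hgT
  obtain ⟨⟨⟨hgE, hgf⟩, hgi⟩, -⟩ := hgT
  refine ⟨c ∘ Equiv.swap s(u, v) g, ⟨hgE, fun j => ?_⟩, ?_⟩
  · by_cases hj : j = i
    · subst hj
      refine IsAcyclic.anti ?_ ((isAcyclic_add_edge_iff_of_not_reachable u v hnr).2
        ((h.2 j).anti (deleteEdges_le _)))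
      intro a b hab
      simp only [colorClass, fromEdgeSet_adj, Set.mem_ofPred_eq, sup_adj, edge, Set.mem_sdiff,
        Set.mem_singleton_iff, deleteEdges_adj, Function.comp_apply, Equiv.swap_apply_def]
        at hab ⊢
      grind
    · refine IsAcyclic.anti ?_ (h.2 j)
      intro a b hab
      simp only [colorClass, fromEdgeSet_adj, Set.mem_ofPred_eq, Set.mem_sdiff,
        Set.mem_singleton_iff, Function.comp_apply, Equiv.swap_apply_def] at hab ⊢
      grind
  · ext e
    simp

lemma IsForestColoring.of_reflTransGen {p q : (Sym2 V → ι) × Sym2 V}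
    (hp : IsForestColoring E p) (h : Relation.ReflTransGen (ExchangeStep E) p q) :
    IsForestColoring E q := by
  cases h with
  | refl => exact hp
  | tail _ h => exact h.1

variable {p : (Sym2 V → ι) × Sym2 V}

/-- If `E` has no colouring by forests, the ends of an uncoloured edge are joined in each colour
class by exchangeable edges. -/
lemma reachable_exchangeable (hE : ¬ ∃ c' : Sym2 V → ι, ∀ j, (colorClass E c' j).IsAcyclic)
    (hp : IsForestColoring E p) {c : Sym2 V → ι} {u v : V}
    (h : Relation.ReflTransGen (ExchangeStep E) p (c, s(u, v))) (i : ι) :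
    (colorClass ((E \ {s(u, v)}) ∩ exchangeable E p) c i).Reachable u v := by
  have hc := hp.of_reflTransGen h
  have hr : (colorClass (E \ {s(u, v)}) c i).Reachable u v := by
    by_contra hr
    exact hE (exists_forest_coloring_of_not_reachable hc hr)
  obtain ⟨w, hw⟩ := hr.exists_isPath
  refine ⟨w.transfer _ fun g hg => ?_⟩
  obtain ⟨c', hc'⟩ := exchangeStep_of_mem_edges hc hw hg
  have hgT := w.edges_subset_edgeSet hg
  simp only [colorClass, edgeSet_fromEdgeSet, Set.mem_sdiff, Set.mem_ofPred_eq, Set.mem_inter_iff]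
    at hgT ⊢
  exact ⟨⟨⟨hgT.1.1, c', h.tail hc'⟩, hgT.1.2⟩, hgT.2⟩

/-- Exchanges do not enlarge the components formed by the exchangeable edges of a colour. -/
lemma reachable_of_reflTransGen
    (hE : ¬ ∃ c' : Sym2 V → ι, ∀ j, (colorClass E c' j).IsAcyclic)
    (hp : IsForestColoring E p) {q : (Sym2 V → ι) × Sym2 V}
    (h : Relation.ReflTransGen (ExchangeStep E) p q) (i : ι) {a b : V}
    (hab : (colorClass ((E \ {q.2}) ∩ exchangeable E p) q.1 i).Reachable a b) :
    (colorClass ((E \ {p.2}) ∩ exchangeable E p) p.1 i).Reachable a b := by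
  classical
  induction h generalizing a b with
  | refl => exact hab
  | @tail q r hq hqr ih =>
    refine ih (reachable_of_le_reachable (fun x y hxy => ?_) hab)
    obtain ⟨c, f⟩ := q
    by_cases hf : s(x, y) = f
    · subst hf
      exact reachable_exchangeable hE hp hq i
    · refine Adj.reachable ?_
      simp only [colorClass, fromEdgeSet_adj, Set.mem_ofPred_eq, Set.mem_sdiff,
        Set.mem_singleton_iff, Set.mem_inter_iff] at hxy ⊢
      rw [hqr.2] at hxy
      simp only [Function.comp_apply] at hxy
      rw [Equiv.swap_apply_of_ne_of_ne hf hxy.1.1.1.2] at hxy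
      exact ⟨⟨⟨⟨hxy.1.1.1.1, hf⟩, hxy.1.1.2⟩, hxy.1.2⟩, hxy.2⟩

lemma reachable_of_mem_exchangeable
    (hE : ¬ ∃ c' : Sym2 V → ι, ∀ j, (colorClass E c' j).IsAcyclic)
    (hp : IsForestColoring E p) {u v : V} (h : s(u, v) ∈ exchangeable E p) (i : ι) :
    (colorClass ((E \ {p.2}) ∩ exchangeable E p) p.1 i).Reachable u v := by
  obtain ⟨c, hc⟩ := h
  exact reachable_of_reflTransGen hE hp hc i (reachable_exchangeable hE hp hc i)

end Exchange

/-- The edges in `E` with both ends in `S`. -/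
def edgesIn {V : Type*} (E : Set (Sym2 V)) (S : Set V) : Set (Sym2 V) :=
  {e ∈ E | ∀ v ∈ e, v ∈ S}

lemma SimpleGraph.edgeSet_induce_image {V : Type*} (H : SimpleGraph V) (S : Set V)
    (A : Set S) :
    Sym2.map Subtype.val '' edgesIn (H.induce S).edgeSet A =
      edgesIn H.edgeSet (Subtype.val '' A) := by
  ext e
  constructor
  · rintro ⟨e, ⟨he, heA⟩, rfl⟩
    induction e with
    | _ a b =>
      refine ⟨by simpa using he, ?_⟩
      simp only [Sym2.mem_iff] at heA
      simp only [Sym2.map_mk, Sym2.mem_iff]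
      rintro v (rfl | rfl)
      · exact ⟨a, heA a (.inl rfl), rfl⟩
      · exact ⟨b, heA b (.inr rfl), rfl⟩
  · induction e with
    | _ a b =>
      rintro ⟨he, hA⟩
      obtain ⟨a, ha, rfl⟩ := hA a (by simp)
      obtain ⟨b, hb, rfl⟩ := hA b (by simp)
      refine ⟨s(a, b), ⟨by simpa using he, ?_⟩, by simp⟩
      simp only [Sym2.mem_iff]
      rintro v (rfl | rfl) <;> assumption

lemma eIn_induce {V : Type*} (H : SimpleGraph V) (S : Set V) (A : Set S) :
    eIn (H.induce S) A = eIn H (Subtype.val '' A) := by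
  change (edgesIn _ _).ncard = (edgesIn _ _).ncard
  rw [← edgeSet_induce_image,
    Set.ncard_image_of_injective _ (Sym2.map.injective Subtype.val_injective)]

lemma ncard_edgeSet_induce {V : Type*} (H : SimpleGraph V) (S : Set V) :
    (H.induce S).edgeSet.ncard = eIn H S := by
  have h := eIn_induce H S Set.univ
  simpa [eIn] using h

lemma SimpleGraph.ConnectedComponent.ncard_supp_le {V : Type*} [Finite V] {H : SimpleGraph V}
    (C : H.ConnectedComponent) : C.supp.ncard ≤ eIn H C.supp + 1 := by
  have := C.connected_toSimpleGraph.card_vert_le_card_edgeSet_add_one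
  rw [← ncard_edgeSet_induce]
  exact this

/-- If all edges of `E` but one can be coloured by `m` forests, but `E` itself cannot, then some
vertex set spans too many edges. -/
lemma exists_dense_of_not_exists_coloring {V : Type*} [Finite V] {m : ℕ} {E : Set (Sym2 V)}
    (hE : ¬ ∃ c : Sym2 V → Fin m, ∀ j, (colorClass E c j).IsAcyclic)
    {p : (Sym2 V → Fin m) × Sym2 V} (hp : IsForestColoring E p) (hm : 0 < m) :
    ∃ S : Set V, S.Nonempty ∧ m * S.ncard < (edgesIn E S).ncard + m := by
  classical
  obtain ⟨c, f⟩ := p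
  induction f with
  | _ u v =>
  set T := fun i => colorClass ((E \ {s(u, v)}) ∩ exchangeable E (c, s(u, v))) c i with hT
  have hreach : ∀ i j a b, (T i).Reachable a b → (T j).Reachable a b := by
    intro i j a b hab
    refine reachable_of_le_reachable (fun x y hxy => ?_) hab
    refine reachable_of_mem_exchangeable hE hp ?_ j
    simp only [hT, colorClass, fromEdgeSet_adj, Set.mem_ofPred_eq, Set.mem_inter_iff] at hxy
    exact hxy.1.1.2
  let C := fun i => (T i).connectedComponentMk u
  let S := (C ⟨0, hm⟩).supp
  have hS : ∀ i, (C i).supp = S := by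
    intro i
    ext w
    simp only [S, C, ConnectedComponent.mem_supp_iff, ConnectedComponent.eq]
    exact ⟨hreach _ _ _ _, hreach _ _ _ _⟩
  have hu : u ∈ S := by simp [S, C]
  have hv : v ∈ S := by
    simp only [S, C, ConnectedComponent.mem_supp_iff, ConnectedComponent.eq]
    exact (reachable_of_mem_exchangeable hE hp ⟨c, .refl⟩ _).symm
  refine ⟨S, ⟨u, hu⟩, ?_⟩
  let A := fun i => edgesIn (T i).edgeSet S
  have hA : ∀ i, S.ncard ≤ (A i).ncard + 1 := fun i => by
    have := (C i).ncard_supp_le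
    rwa [hS] at this
  have hAc : ∀ i, ∀ e ∈ A i, e ∈ E ∧ e ≠ s(u, v) ∧ c e = i := by
    rintro i e ⟨he, -⟩
    simp only [hT, colorClass, edgeSet_fromEdgeSet, Set.mem_sdiff, Set.mem_ofPred_eq,
      Set.mem_inter_iff, Set.mem_singleton_iff] at he
    exact ⟨he.1.1.1.1, he.1.1.1.2, he.1.2⟩
  have hdisj : Pairwise (Function.onFun Disjoint A) := by
    intro i j hij
    rw [Function.onFun, Set.disjoint_left]
    exact fun e hi hj => hij ((hAc i e hi).2.2.symm.trans (hAc j e hj).2.2)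
  have hcard : (⋃ i, A i).ncard = ∑ i, (A i).ncard := by
    rw [Set.ncard_iUnion_of_finite (fun _ => Set.toFinite _) hdisj, finsum_eq_sum_of_fintype]
  have hnot : s(u, v) ∉ ⋃ i, A i := by
    simp only [Set.mem_iUnion, not_exists]
    exact fun i h => (hAc i _ h).2.1 rfl
  have hsub : insert s(u, v) (⋃ i, A i) ⊆ edgesIn E S := by
    intro e he
    rcases he with rfl | he
    · refine ⟨hp.1, ?_⟩
      simp only [Sym2.mem_iff]
      rintro w (rfl | rfl) <;> assumption
    · obtain ⟨i, hi⟩ := Set.mem_iUnion.1 he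
      exact ⟨(hAc i e hi).1, hi.2⟩
  have h1 := Set.ncard_le_ncard hsub (Set.toFinite _)
  rw [Set.ncard_insert_of_notMem hnot (Set.toFinite _), hcard] at h1
  have h2 : ∑ _i : Fin m, S.ncard ≤ ∑ i, ((A i).ncard + 1) := Finset.sum_le_sum fun i _ => hA i
  simp only [Finset.sum_const, Finset.card_univ, Fintype.card_fin, smul_eq_mul,
    Finset.sum_add_distrib, mul_one] at h2
  omega

/-- The Nash-Williams arboricity theorem. -/
theorem exists_forest_coloring {V : Type*} [Finite V] {m : ℕ} (hm : 0 < m)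
    (E : Set (Sym2 V)) (hE : ∀ S : Set V, S.Nonempty → (edgesIn E S).ncard + m ≤ m * S.ncard) :
    ∃ c : Sym2 V → Fin m, ∀ j, (colorClass E c j).IsAcyclic := by
  induction E, Set.toFinite E using Set.Finite.induction_on with
  | empty => exact ⟨fun _ => ⟨0, hm⟩, fun j => by simp [colorClass]⟩
  | @insert f E hf _ ih =>
    obtain ⟨c, hc⟩ := ih fun S hS => by
      refine le_trans ?_ (hE S hS)
      gcongr
      · exact Set.toFinite _
      · exact fun e he => ⟨Set.mem_insert_of_mem _ he.1, he.2⟩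
    by_contra hcon
    obtain ⟨S, hS, h⟩ := exists_dense_of_not_exists_coloring (p := (c, f)) hcon
      ⟨Set.mem_insert _ _, by simpa [Set.insert_sdiff_of_mem, Set.sdiff_singleton_eq_self hf]⟩ hm
    exact absurd (hE S hS) (by omega)

lemma SimpleGraph.IsTree.ncard_edgeSet_add_one {V : Type*} [Finite V] {T : SimpleGraph V}
    (hT : T.IsTree) : T.edgeSet.ncard + 1 = Nat.card V :=
  (isTree_iff_connected_and_card.1 hT).2

lemma SimpleGraph.IsAcyclic.exists_isTree_ge {V : Type*} [Nonempty V] {H : SimpleGraph V}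
    (hH : H.IsAcyclic) : ∃ T, H ≤ T ∧ T.IsTree := by
  obtain ⟨T, hT⟩ := connected_top.exists_isTree_le_of_le_of_isAcyclic le_top hH
  exact ⟨T, hT.1, hT.2.2⟩

lemma IsSparse.eIn_add_le {V : Type*} {m : ℕ} {F : SimpleGraph V} (h : IsSparse m F)
    {S : Set V} (hS : S.Nonempty) : eIn F S + m ≤ m * S.ncard := by
  have := h S hS
  zify
  linarith

/-- A sparse graph with the maximum number of edges on a vertex set is tree-connected there. -/
lemma IsSparse.isTreeConn_induce {V : Type*} [Finite V] {m : ℕ} (hm : 0 < m)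
    {F : SimpleGraph V} (h : IsSparse m F) {S : Set V} (hS : S.Nonempty)
    (ht : m * S.ncard ≤ eIn F S + m) : IsTreeConn m (F.induce S) := by
  have : Nonempty S := hS.to_subtype
  obtain ⟨c, hc⟩ := exists_forest_coloring hm (F.induce S).edgeSet fun A hA => by
    change eIn (F.induce S) A + m ≤ _
    rw [eIn_induce, ← Set.ncard_image_of_injective A Subtype.val_injective]
    exact h.eIn_add_le (hA.image _)
  have hedge : ∀ i, (colorClass (F.induce S).edgeSet c i).edgeSet =
      {e ∈ (F.induce S).edgeSet | c e = i} := by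
    intro i
    rw [colorClass, edgeSet_fromEdgeSet, sdiff_eq_left, Set.disjoint_left]
    exact fun e he hd => (F.induce S).not_isDiag_of_mem_edgeSet he.1 hd
  have hdisj : Pairwise (Function.onFun Disjoint
      fun i => (colorClass (F.induce S).edgeSet c i).edgeSet) := by
    intro i j hij
    rw [Function.onFun, Set.disjoint_left]
    intro e hi hj
    rw [hedge] at hi hj
    exact hij (hi.2.symm.trans hj.2)
  refine ⟨colorClass (F.induce S).edgeSet c, fun i => ?_, fun i => ?_, fun i j hij => hdisj hij⟩
  · rw [← edgeSet_subset_edgeSet, hedge]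
    exact Set.sep_subset _ _
  · choose T hle hT using fun i => (hc i).exists_isTree_ge
    have hcard : ∑ i, (colorClass (F.induce S).edgeSet c i).edgeSet.ncard = eIn F S := by
      rw [← ncard_edgeSet_induce, ← finsum_eq_sum_of_fintype,
        ← Set.ncard_iUnion_of_finite (fun _ => Set.toFinite _) hdisj]
      congr 1
      ext e
      simp [hedge]
    have hTcard : ∑ i, ((T i).edgeSet.ncard + 1) = m * S.ncard := by
      simp only [(hT _).ncard_edgeSet_add_one, Finset.sum_const, Finset.card_univ,
        Fintype.card_fin, smul_eq_mul, Nat.card_coe_set_eq]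
    rw [Finset.sum_add_distrib] at hTcard
    simp only [Finset.sum_const, Finset.card_univ, Fintype.card_fin, smul_eq_mul, mul_one]
      at hTcard
    have hsub : ∀ i, (colorClass (F.induce S).edgeSet c i).edgeSet ⊆ (T i).edgeSet :=
      fun i => edgeSet_subset_edgeSet.2 (hle i)
    have hmono : ∀ i ∈ Finset.univ, (colorClass (F.induce S).edgeSet c i).edgeSet.ncard ≤
        (T i).edgeSet.ncard := fun i _ => Set.ncard_le_ncard (hsub i) (Set.toFinite _)
    have heq := (Finset.sum_eq_sum_iff_of_le hmono).1
      (le_antisymm (Finset.sum_le_sum hmono) (by omega)) i (Finset.mem_univ i)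
    have := edgeSet_inj.1 (Set.eq_of_subset_of_ncard_le (hsub i) heq.ge (Set.toFinite _))
    rw [this]
    exact hT i

lemma IsTreeConn.le_eIn {V : Type*} [Finite V] {m : ℕ} {F : SimpleGraph V} {S : Set V}
    (h : IsTreeConn m (F.induce S)) : m * S.ncard ≤ eIn F S + m := by
  obtain ⟨T, hle, hT, hdisj⟩ := h
  have hcard : (⋃ i, (T i).edgeSet).ncard = ∑ i, (T i).edgeSet.ncard := by
    rw [Set.ncard_iUnion_of_finite (fun _ => Set.toFinite _) fun i j hij => hdisj i j hij,
      finsum_eq_sum_of_fintype]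
  have hsub : (⋃ i, (T i).edgeSet) ⊆ (F.induce S).edgeSet :=
    Set.iUnion_subset fun i => edgeSet_subset_edgeSet.2 (hle i)
  have h1 := Set.ncard_le_ncard hsub (Set.toFinite _)
  rw [hcard, ncard_edgeSet_induce] at h1
  have h2 : ∑ i, ((T i).edgeSet.ncard + 1) = m * S.ncard := by
    simp only [(hT _).ncard_edgeSet_add_one, Finset.sum_const, Finset.card_univ,
      Fintype.card_fin, smul_eq_mul, Nat.card_coe_set_eq]
  rw [Finset.sum_add_distrib] at h2
  simp only [Finset.sum_const, Finset.card_univ, Fintype.card_fin, smul_eq_mul, mul_one] at h2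
  omega

lemma eIn_add_eIn_le {V : Type*} [Finite V] (F : SimpleGraph V) (X Y : Set V) :
    eIn F X + eIn F Y ≤ eIn F (X ∪ Y) + eIn F (X ∩ Y) := by
  have h := Set.ncard_union_add_ncard_inter (edgesIn F.edgeSet X) (edgesIn F.edgeSet Y)
  have hi : edgesIn F.edgeSet X ∩ edgesIn F.edgeSet Y = edgesIn F.edgeSet (X ∩ Y) := by
    ext e
    simp only [edgesIn, Set.mem_inter_iff, Set.mem_ofPred_eq]
    grind
  have hu : edgesIn F.edgeSet X ∪ edgesIn F.edgeSet Y ⊆ edgesIn F.edgeSet (X ∪ Y) := by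
    rintro e (he | he)
    · exact ⟨he.1, fun v hv => .inl (he.2 v hv)⟩
    · exact ⟨he.1, fun v hv => .inr (he.2 v hv)⟩
  have hle := Set.ncard_le_ncard hu (Set.toFinite _)
  rw [hi] at h
  change (edgesIn _ _).ncard + (edgesIn _ _).ncard ≤ (edgesIn _ _).ncard + (edgesIn _ _).ncard
  omega

/-- In a sparse graph, tree-connected vertex sets that meet have a tree-connected union. -/
lemma IsSparse.isTreeConn_union {V : Type*} [Finite V] {m : ℕ} (hm : 0 < m)
    {F : SimpleGraph V} (h : IsSparse m F) {X Y : Set V} (hXY : (X ∩ Y).Nonempty)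
    (hX : IsTreeConn m (F.induce X)) (hY : IsTreeConn m (F.induce Y)) :
    IsTreeConn m (F.induce (X ∪ Y)) := by
  refine h.isTreeConn_induce hm (hXY.left.mono Set.subset_union_left) ?_
  have h1 := eIn_add_eIn_le F X Y
  have h2 := hX.le_eIn
  have h3 := hY.le_eIn
  have h4 := h.eIn_add_le hXY
  have h5 := congrArg (m * ·) (Set.ncard_union_add_ncard_inter X Y)
  simp only [mul_add] at h5
  omega

lemma IsSparse.mComp_subset {V : Type*} [Finite V] {m : ℕ} (hm : 0 < m)
    {F : SimpleGraph V} (h : IsSparse m F) {S : Set V} (hS : IsTreeConn m (F.induce S))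
    {x y : V} (hx : x ∈ S) (hy : y ∈ S) : mComp m F x ⊆ mComp m F y := by
  rintro z ⟨X, ⟨hxX, hX⟩, hz⟩
  exact ⟨X ∪ S, ⟨.inr hy, h.isTreeConn_union hm ⟨x, hxX, hx⟩ hX hS⟩, .inl hz⟩

theorem stmt5 {V : Type*} [Fintype V] (m : ℕ) (hm : 0 < m) (G F : SimpleGraph V)
    (hFG : F ≤ G) (hsp : IsSparse m F) (x y : V)
    (hxy : G.Adj x y) (hnF : ¬ F.Adj x y)
    (hcomp : mComp m F x ≠ mComp m F y) :
    IsSparse m (F ⊔ SimpleGraph.fromEdgeSet {s(x, y)}) := by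
  intro S hS
  have h := hsp.eIn_add_le hS
  suffices hlt : eIn (F ⊔ fromEdgeSet {s(x, y)}) S + m ≤ m * S.ncard by
    zify at hlt
    linarith
  have hmem : ∀ e ∈ edgesIn (F ⊔ fromEdgeSet {s(x, y)}).edgeSet S,
      e ∈ edgesIn F.edgeSet S ∨ e = s(x, y) := by
    rintro e ⟨he, heS⟩
    rw [edgeSet_sup, edgeSet_fromEdgeSet] at he
    exact he.imp (fun he => ⟨he, heS⟩) fun he => he.1
  by_cases hxyS : x ∈ S ∧ y ∈ S
  · have hlt : eIn F S + m < m * S.ncard := by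
      by_contra! hge
      have hT := hsp.isTreeConn_induce hm hS hge
      exact hcomp ((hsp.mComp_subset hm hT hxyS.1 hxyS.2).antisymm
        (hsp.mComp_subset hm hT hxyS.2 hxyS.1))
    have hle : eIn (F ⊔ fromEdgeSet {s(x, y)}) S ≤ eIn F S + 1 :=
      (Set.ncard_le_ncard (t := insert s(x, y) (edgesIn F.edgeSet S))
        (fun e he => (hmem e he).symm) (Set.toFinite _)).trans (Set.ncard_insert_le _ _)
    omega
  · have hle : eIn (F ⊔ fromEdgeSet {s(x, y)}) S ≤ eIn F S := by
      refine Set.ncard_le_ncard (fun e he => (hmem e he).resolve_right ?_) (Set.toFinite _)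
      rintro rfl
      exact hxyS ⟨he.2 x (by simp), he.2 y (by simp)⟩
    omega
end

section
/- Let G be a k-tree-connected graph with k ≥ m, and let S ⊆ V(G). Then Ω_m(G \ S) ≤ Σ_{v∈S}( m(d_G(v)-m)/k − m ) + m + (m/k)·Ω_m(G[S]). -/
open SimpleGraph

/-- The vertex set `X` carries `m` pairwise edge-disjoint connected spanning subgraphs of `G`. -/
def IsPacked {V : Type*} (m : ℕ) (G : SimpleGraph V) (X : Set V) : Prop :=
  ∃ T : Fin m → SimpleGraph V, (∀ i, T i ≤ G) ∧ (∀ i, ((T i).induce X).Connected) ∧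
    ∀ i j u v, (T i).Adj u v → (T j).Adj u v → i = j

theorem isTreeConn_induce_iff {V : Type*} {m : ℕ} {G : SimpleGraph V} {X : Set V} :
    IsTreeConn m (G.induce X) ↔ IsPacked m G X := by
  constructor
  · rintro ⟨T, hle, htree, hdisj⟩
    refine ⟨fun i ↦ (T i).map (Function.Embedding.subtype _), fun i ↦ ?_, fun i ↦ ?_, ?_⟩
    · intro u v huv
      obtain ⟨a, b, hab, rfl, rfl⟩ := (SimpleGraph.map_adj _ _ _ _).1 huv
      exact hle i hab
    · have : ((T i).map (Function.Embedding.subtype _)).induce X = T i :=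
        SimpleGraph.comap_map_eq _ _
      rw [this]
      exact (htree i).1
    · intro i j u v hi hj
      obtain ⟨a, b, hab, rfl, rfl⟩ := (SimpleGraph.map_adj _ _ _ _).1 hi
      obtain ⟨c, d, hcd, hc, hd⟩ := (SimpleGraph.map_adj _ _ _ _).1 hj
      obtain rfl := (Function.Embedding.subtype _).injective hc
      obtain rfl := (Function.Embedding.subtype _).injective hd
      by_contra hij
      exact Set.disjoint_left.1 (hdisj i j hij) ((T i).mem_edgeSet.2 hab)
        ((T j).mem_edgeSet.2 hcd)
  · rintro ⟨T, hle, hconn, hdisj⟩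
    choose T' hT' htree using fun i ↦ (hconn i).exists_isTree_le
    refine ⟨T', fun i u v h ↦ hle i (hT' i h), htree, fun i j hij ↦ ?_⟩
    rw [Set.disjoint_left]
    intro e
    induction e with
    | _ u v =>
      intro hi hj
      exact hij (hdisj i j u v (hT' i hi) (hT' j hj))

theorem IsPacked.union {V : Type*} {m : ℕ} {G : SimpleGraph V} {X Y : Set V}
    (hX : IsPacked m G X) (hY : IsPacked m G Y) (hXY : (X ∩ Y).Nonempty) :
    IsPacked m G (X ∪ Y) := by
  obtain ⟨T, hle, hconn, hdisj⟩ := hX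
  obtain ⟨U, hle', hconn', hdisj'⟩ := hY
  obtain ⟨w, hwX, hwY⟩ := hXY
  let R : Fin m → SimpleGraph V := fun i ↦
    { Adj := fun u v ↦ (u ∈ X ∧ v ∈ X) ∧ (T i).Adj u v ∨ ¬(u ∈ X ∧ v ∈ X) ∧ (U i).Adj u v
      symm := ⟨fun u v h ↦ by
        rcases h with ⟨⟨h1, h2⟩, h3⟩ | ⟨h1, h2⟩
        · exact Or.inl ⟨⟨h2, h1⟩, h3.symm⟩
        · exact Or.inr ⟨fun h ↦ h1 h.symm, h2.symm⟩⟩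
      loopless := ⟨fun u h ↦ by
        rcases h with ⟨_, h⟩ | ⟨_, h⟩ <;> exact h.ne rfl⟩ }
  refine ⟨R, fun i u v h ↦ ?_, fun i ↦ ?_, fun i j u v hi hj ↦ ?_⟩
  · rcases h with ⟨_, h⟩ | ⟨_, h⟩
    exacts [hle i h, hle' i h]
  · let w' : ↥(X ∪ Y) := ⟨w, Or.inl hwX⟩
    have hreachX : ∀ x (hx : x ∈ X), ((R i).induce (X ∪ Y)).Reachable ⟨x, Or.inl hx⟩ w' := by
      intro x hx
      let f : (T i).induce X →g (R i).induce (X ∪ Y) :=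
        { toFun := fun a ↦ ⟨a, Or.inl a.2⟩
          map_rel' := fun {a b} h ↦ Or.inl ⟨⟨a.2, b.2⟩, h⟩ }
      exact ((hconn i).preconnected ⟨x, hx⟩ ⟨w, hwX⟩).map f
    have hreachY : ∀ y (hy : y ∈ Y), ((R i).induce (X ∪ Y)).Reachable ⟨y, Or.inr hy⟩ w' := by
      intro y hy
      obtain ⟨p⟩ := (hconn' i).preconnected ⟨y, hy⟩ ⟨w, hwY⟩
      suffices ∀ a b : Y, ((U i).induce Y).Walk a b → b.1 ∈ X →
          ((R i).induce (X ∪ Y)).Reachable ⟨a, Or.inr a.2⟩ w' from this _ _ p hwX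
      intro a b p hb
      induction p with
      | nil => exact hreachX _ hb
      | @cons a c b h q ih =>
        by_cases ha : a.1 ∈ X
        · exact hreachX _ ha
        · refine SimpleGraph.Reachable.trans (SimpleGraph.Adj.reachable ?_) (ih hb)
          exact Or.inr ⟨fun h' ↦ ha h'.1, h⟩
    have hreach : ∀ x, ((R i).induce (X ∪ Y)).Reachable x w' := by
      rintro ⟨x, hx | hx⟩
      exacts [hreachX x hx, hreachY x hx]
    have : Nonempty ↥(X ∪ Y) := ⟨w'⟩
    exact ⟨fun x y ↦ (hreach x).trans (hreach y).symm⟩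
  · rcases hi with ⟨h, hi⟩ | ⟨h, hi⟩ <;> rcases hj with ⟨h', hj⟩ | ⟨h', hj⟩
    · exact hdisj i j u v hi hj
    · exact absurd h h'
    · exact absurd h' h
    · exact hdisj' i j u v hi hj

theorem isPacked_singleton {V : Type*} (m : ℕ) (G : SimpleGraph V) (v : V) :
    IsPacked m G {v} := by
  refine ⟨fun _ ↦ ⊥, fun _ ↦ bot_le, fun _ ↦ ?_, fun _ _ _ _ h ↦ h.elim⟩
  have : Nonempty ↥({v} : Set V) := ⟨⟨v, rfl⟩⟩
  refine ⟨fun x y ↦ ?_⟩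
  rw [Subsingleton.elim x y]

theorem mem_mComp_self {V : Type*} (m : ℕ) (G : SimpleGraph V) (v : V) : v ∈ mComp m G v :=
  ⟨{v}, ⟨rfl, isTreeConn_induce_iff.2 (isPacked_singleton m G v)⟩, rfl⟩

theorem isPacked_mComp {V : Type*} [Finite V] (m : ℕ) (G : SimpleGraph V) (v : V) :
    IsPacked m G (mComp m G v) := by
  obtain ⟨X, hX⟩ := (Set.toFinite {X : Set V | v ∈ X ∧ IsPacked m G X}).exists_maximal
    ⟨{v}, rfl, isPacked_singleton m G v⟩
  have : mComp m G v = X := by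
    apply Set.Subset.antisymm
    · rintro u ⟨Y, ⟨hvY, hY⟩, hu⟩
      exact hX.2 ⟨Or.inl hX.1.1, hX.1.2.union (isTreeConn_induce_iff.1 hY) ⟨v, hX.1.1, hvY⟩⟩
        Set.subset_union_left (Or.inr hu)
    · exact Set.subset_sUnion_of_mem ⟨hX.1.1, isTreeConn_induce_iff.2 hX.1.2⟩
  exact this ▸ hX.1.2

theorem mem_mComp_iff {V : Type*} [Finite V] {m : ℕ} {G : SimpleGraph V} {v w : V} :
    w ∈ mComp m G v ↔ mComp m G w = mComp m G v := by
  refine ⟨fun h ↦ ?_, fun h ↦ h ▸ mem_mComp_self m G w⟩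
  have key : ∀ {a b : V}, a ∈ mComp m G b → mComp m G b ⊆ mComp m G a := fun {a b} hab ↦
    Set.subset_sUnion_of_mem ⟨hab, isTreeConn_induce_iff.2 (isPacked_mComp m G b)⟩
  exact (key (key h (mem_mComp_self m G v))).antisymm (key h)

theorem IsPacked.mul_ncard_le {V : Type*} [Finite V] {m : ℕ} {G : SimpleGraph V} {X : Set V}
    (hX : IsPacked m G X) : m * X.ncard ≤ eIn G X + m := by
  obtain ⟨T, hle, hconn, hdisj⟩ := hX
  let F : Fin m → Set (Sym2 V) := fun i ↦ Sym2.map Subtype.val '' ((T i).induce X).edgeSet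
  have hF : ∀ i, X.ncard ≤ (F i).ncard + 1 := fun i ↦ by
    rw [Set.ncard_image_of_injective _ (Sym2.map.injective Subtype.val_injective)]
    exact (hconn i).card_vert_le_card_edgeSet_add_one
  have hFT : ∀ i, F i ⊆ (T i).edgeSet := by
    rintro i _ ⟨e, he, rfl⟩
    induction e with
    | _ u v => exact he
  have hpair : Pairwise (Function.onFun Disjoint F) := fun i j hij ↦ by
    refine Set.disjoint_left.2 fun e hi hj ↦ hij ?_
    have hi := hFT i hi
    have hj := hFT j hj
    induction e with
    | _ u v => exact hdisj i j u v hi hj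
  have hsub : (⋃ i, F i) ⊆ {e ∈ G.edgeSet | ∀ v ∈ e, v ∈ X} := by
    refine Set.iUnion_subset fun i e he ↦ ⟨SimpleGraph.edgeSet_mono (hle i) (hFT i he), ?_⟩
    obtain ⟨e, -, rfl⟩ := he
    intro v hv
    obtain ⟨a, -, rfl⟩ := Sym2.mem_map.1 hv
    exact a.2
  have hcard : ∑ i, (F i).ncard ≤ eIn G X := by
    rw [← finsum_eq_sum_of_fintype,
      ← Set.ncard_iUnion_of_finite (fun i ↦ Set.toFinite _) hpair]
    exact Set.ncard_le_ncard hsub (Set.toFinite _)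
  calc m * X.ncard = ∑ _i : Fin m, X.ncard := by simp
    _ ≤ ∑ i, ((F i).ncard + 1) := Finset.sum_le_sum fun i _ ↦ hF i
    _ = ∑ i, (F i).ncard + m := by simp [Finset.sum_add_distrib]
    _ ≤ _ := by gcongr

theorem mul_card_add_crossE_le {V : Type*} [Finite V] (m : ℕ) (G : SimpleGraph V) :
    m * Nat.card V + crossE m G ≤ G.edgeSet.ncard + m * (Set.range (mComp m G)).ncard := by
  classical
  let Q : Set (Set V) := Set.range (mComp m G)
  let I : Set V → Set (Sym2 V) := fun X ↦ {e ∈ G.edgeSet | ∀ v ∈ e, v ∈ X}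
  have hQdisj : ∀ X ∈ Q, ∀ Y ∈ Q, ∀ v, v ∈ X → v ∈ Y → X = Y := by
    rintro _ ⟨a, rfl⟩ _ ⟨b, rfl⟩ v ha hb
    rw [← mem_mComp_iff.1 ha, ← mem_mComp_iff.1 hb]
  have hQ : Q.Finite := Set.toFinite _
  have hV : Nat.card V = ∑ X ∈ hQ.toFinset, X.ncard := by
    rw [← finsum_mem_eq_finite_toFinset_sum, ← Set.ncard_univ,
      ← hQ.ncard_biUnion (s := fun X ↦ X) (fun _ _ ↦ Set.toFinite _)]
    · congr 1
      symm
      refine Set.eq_univ_of_forall fun v ↦ ?_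
      exact Set.mem_biUnion (Set.mem_range_self v) (mem_mComp_self m G v)
    · exact fun X hX Y hY hXY ↦ Set.disjoint_left.2 fun v hvX hvY ↦
        hXY (hQdisj X hX Y hY v hvX hvY)
  have hE : ∑ X ∈ hQ.toFinset, eIn G X + crossE m G ≤ G.edgeSet.ncard := by
    have hdisj : Q.PairwiseDisjoint I := fun X hX Y hY hXY ↦ by
      refine Set.disjoint_left.2 fun e he he' ↦ hXY ?_
      induction e with
      | _ u v => exact hQdisj X hX Y hY u (he.2 u (by simp)) (he'.2 u (by simp))
    rw [← finsum_mem_eq_finite_toFinset_sum]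
    change ∑ᶠ X ∈ Q, (I X).ncard + Set.ncard _ ≤ _
    rw [← hQ.ncard_biUnion (fun _ _ ↦ Set.toFinite _) hdisj, ← Set.ncard_union_eq]
    · refine Set.ncard_le_ncard (Set.union_subset (Set.iUnion₂_subset fun X _ e he ↦ he.1) ?_)
        (Set.toFinite _)
      exact fun e he ↦ he.1
    · refine Set.disjoint_left.2 fun e he he' ↦ ?_
      obtain ⟨X, hX, -, he⟩ := Set.mem_iUnion₂.1 he
      obtain ⟨a, rfl⟩ := hX
      obtain ⟨-, u, hu, w, hw, huw⟩ := he'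
      exact huw ((mem_mComp_iff.1 (he u hu)).trans (mem_mComp_iff.1 (he w hw)).symm)
  have hsum : m * ∑ X ∈ hQ.toFinset, X.ncard ≤ ∑ X ∈ hQ.toFinset, eIn G X + m * Q.ncard := by
    calc m * ∑ X ∈ hQ.toFinset, X.ncard = ∑ X ∈ hQ.toFinset, m * X.ncard := Finset.mul_sum _ _ _
      _ ≤ ∑ X ∈ hQ.toFinset, (eIn G X + m) := by
        refine Finset.sum_le_sum fun X hX ↦ IsPacked.mul_ncard_le ?_
        obtain ⟨a, rfl⟩ := hQ.mem_toFinset.1 hX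
        exact isPacked_mComp m G a
      _ = _ := by
        rw [Finset.sum_add_distrib, Finset.sum_const, smul_eq_mul, mul_comm,
          Set.ncard_eq_toFinset_card Q hQ, mul_comm m]
  rw [hV]
  change _ ≤ _ + m * Q.ncard
  omega

theorem SimpleGraph.Connected.ncard_range_le {V α : Type*} [Finite V] {T : SimpleGraph V}
    (hT : T.Connected) (f : V → α) :
    (Set.range f).ncard ≤ {e ∈ T.edgeSet | ∃ u ∈ e, ∃ w ∈ e, f u ≠ f w}.ncard + 1 := by
  let g : V → Set.range f := Set.rangeFactorization f
  have hg : Function.Surjective g := Set.rangeFactorization_surjective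
  have hwalk : ∀ u v, T.Walk u v → (T.map g).Reachable (g u) (g v) := by
    intro u v p
    induction p with
    | nil => rfl
    | @cons a b c h q ih =>
      refine SimpleGraph.Reachable.trans ?_ ih
      by_cases hab : g a = g b
      · rw [hab]
      · exact SimpleGraph.Adj.reachable ⟨hab, a, b, h, rfl, rfl⟩
  have hne : Nonempty (Set.range f) := hT.nonempty.map g
  have hconn : (T.map g).Connected := by
    refine ⟨fun x y ↦ ?_⟩
    obtain ⟨u, rfl⟩ := hg x
    obtain ⟨v, rfl⟩ := hg y
    obtain ⟨p⟩ := hT.preconnected u v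
    exact hwalk u v p
  have hsub : (T.map g).edgeSet ⊆
      Sym2.map g '' {e ∈ T.edgeSet | ∃ u ∈ e, ∃ w ∈ e, f u ≠ f w} := by
    intro e
    induction e with
    | _ x y =>
      rintro ⟨hxy, a, b, hab, rfl, rfl⟩
      exact ⟨s(a, b), ⟨hab, a, by simp, b, by simp, fun h ↦ hxy (Subtype.ext h)⟩, rfl⟩
  have h1 : (Set.range f).ncard ≤ (T.map g).edgeSet.ncard + 1 :=
    hconn.card_vert_le_card_edgeSet_add_one
  have h2 := (Set.ncard_le_ncard hsub (Set.toFinite _)).trans (Set.ncard_image_le (Set.toFinite _))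
  omega

theorem IsTreeConn.mul_ncard_range_le {V α : Type*} [Finite V] {k : ℕ} {G : SimpleGraph V}
    (hG : IsTreeConn k G) (f : V → α) :
    k * (Set.range f).ncard ≤ {e ∈ G.edgeSet | ∃ u ∈ e, ∃ w ∈ e, f u ≠ f w}.ncard + k := by
  obtain ⟨T, hle, htree, hdisj⟩ := hG
  let F : Fin k → Set (Sym2 V) := fun i ↦ {e ∈ (T i).edgeSet | ∃ u ∈ e, ∃ w ∈ e, f u ≠ f w}
  have hpair : Pairwise (Function.onFun Disjoint F) := fun i j hij ↦
    (hdisj i j hij).mono (fun _ h ↦ h.1) (fun _ h ↦ h.1)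
  have hcard : ∑ i, (F i).ncard ≤ {e ∈ G.edgeSet | ∃ u ∈ e, ∃ w ∈ e, f u ≠ f w}.ncard := by
    rw [← finsum_eq_sum_of_fintype,
      ← Set.ncard_iUnion_of_finite (fun i ↦ Set.toFinite _) hpair]
    exact Set.ncard_le_ncard (Set.iUnion_subset fun i e he ↦
      ⟨SimpleGraph.edgeSet_mono (hle i) he.1, he.2⟩) (Set.toFinite _)
  calc k * (Set.range f).ncard = ∑ _i : Fin k, (Set.range f).ncard := by simp
    _ ≤ ∑ i, ((F i).ncard + 1) := Finset.sum_le_sum fun i _ ↦ (htree i).1.ncard_range_le f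
    _ = ∑ i, (F i).ncard + k := by simp [Finset.sum_add_distrib]
    _ ≤ _ := by gcongr

theorem ncard_edges_meeting_add_le_sum_degree {V : Type*} [Fintype V] (G : SimpleGraph V)
    (S : Finset V) :
    {e ∈ G.edgeSet | ∃ v ∈ e, v ∈ S}.ncard + (G.induce (S : Set V)).edgeSet.ncard ≤
      ∑ v ∈ S, (G.neighborSet v).ncard := by
  classical
  have hdeg : ∀ v, (G.neighborSet v).ncard = (G.edgeFinset.filter (v ∈ ·)).card := fun v ↦ by
    rw [← SimpleGraph.incidenceFinset_eq_filter, SimpleGraph.card_incidenceFinset_eq_degree,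
      ← SimpleGraph.card_neighborSet_eq_degree, Set.ncard_eq_toFinset_card', Set.toFinset_card]
  have hmeet : {e ∈ G.edgeSet | ∃ v ∈ e, v ∈ S}.ncard =
      (G.edgeFinset.filter fun e ↦ ∃ v ∈ e, v ∈ S).card := by
    rw [← Set.ncard_coe_finset]
    congr 1
    ext e
    simp
  have hin : (G.induce (S : Set V)).edgeSet.ncard ≤
      (G.edgeFinset.filter fun e ↦ ∀ v ∈ e, v ∈ S).card := by
    rw [← Set.ncard_image_of_injective _ (Sym2.map.injective Subtype.val_injective),
      ← Set.ncard_coe_finset]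
    refine Set.ncard_le_ncard ?_ (Set.toFinite _)
    rintro _ ⟨e, he, rfl⟩
    induction e with
    | _ u v => simpa using he
  rw [Finset.sum_congr rfl fun v _ ↦ hdeg v, hmeet]
  refine (Nat.add_le_add_left hin _).trans ?_
  rw [show ∑ v ∈ S, (G.edgeFinset.filter (v ∈ ·)).card =
      ∑ e ∈ G.edgeFinset, (S.filter (· ∈ e)).card from
    Finset.sum_card_bipartiteAbove_eq_sum_card_bipartiteBelow (fun v e ↦ v ∈ e),
    Finset.card_filter, Finset.card_filter, ← Finset.sum_add_distrib]
  refine Finset.sum_le_sum fun e he ↦ ?_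
  induction e with
  | _ u v =>
    have huv : u ≠ v := (SimpleGraph.mem_edgeFinset.1 he : G.Adj u v).ne
    have : S.filter (· ∈ s(u, v)) = ({u, v} : Finset V).filter (· ∈ S) := by
      ext x
      simp [and_comm]
    rw [this, Finset.filter_insert, Finset.filter_singleton]
    by_cases hu : u ∈ S <;> by_cases hv : v ∈ S <;> simp [hu, hv, huv]

theorem IsTreeConn.mul_components_le {V : Type*} [Fintype V] {k : ℕ} {G : SimpleGraph V}
    (hG : IsTreeConn k G) (m : ℕ) (S : Finset V) :
    k * ((Set.range (mComp m (G.induce ((↑S : Set V)ᶜ)))).ncard + S.card) ≤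
      crossE m (G.induce ((↑S : Set V)ᶜ)) + {e ∈ G.edgeSet | ∃ v ∈ e, v ∈ S}.ncard + k := by
  classical
  let H := G.induce ((↑S : Set V)ᶜ)
  let f : V → Set ↥((↑S : Set V)ᶜ) ⊕ V := fun v ↦
    if h : v ∈ (↑S : Set V)ᶜ then Sum.inl (mComp m H ⟨v, h⟩) else Sum.inr v
  have hf : ∀ v (h : v ∈ (↑S : Set V)ᶜ), f v = Sum.inl (mComp m H ⟨v, h⟩) := fun v h ↦ dif_pos h
  have hf' : ∀ v ∈ S, f v = Sum.inr v := fun v h ↦ dif_neg (by simpa using h)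
  have hrange : (Set.range (mComp m H)).ncard + S.card ≤ (Set.range f).ncard := by
    rw [← Set.ncard_image_of_injective (Set.range (mComp m H)) (Sum.inl_injective (β := V)),
      ← Set.ncard_coe_finset S,
      ← Set.ncard_image_of_injective (S : Set V)
        (Sum.inr_injective (α := Set ↥((↑S : Set V)ᶜ))), ← Set.ncard_union_eq]
    · refine Set.ncard_le_ncard (Set.union_subset ?_ ?_) (Set.toFinite _)
      · rintro _ ⟨_, ⟨⟨v, hv⟩, rfl⟩, rfl⟩
        exact ⟨v, hf v hv⟩
      · rintro _ ⟨v, hv, rfl⟩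
        exact ⟨v, hf' v hv⟩
    · refine Set.disjoint_left.2 ?_
      rintro _ ⟨_, -, rfl⟩ ⟨_, -, h⟩
      cases h
  have hedge : {e ∈ G.edgeSet | ∃ u ∈ e, ∃ w ∈ e, f u ≠ f w}.ncard ≤
      crossE m H + {e ∈ G.edgeSet | ∃ v ∈ e, v ∈ S}.ncard := by
    unfold crossE
    rw [← Set.ncard_image_of_injective _ (Sym2.map.injective Subtype.val_injective)]
    refine (Set.ncard_le_ncard ?_ (Set.toFinite _)).trans (Set.ncard_union_le _ _)
    rintro e ⟨he, u, hu, w, hw, huw⟩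
    by_cases hS : ∃ v ∈ e, v ∈ S
    · exact Or.inr ⟨he, hS⟩
    · left
      push Not at hS
      have hu' : u ∈ (↑S : Set V)ᶜ := by simpa using hS u hu
      have hw' : w ∈ (↑S : Set V)ᶜ := by simpa using hS w hw
      have hne : u ≠ w := fun h ↦ huw (congrArg f h)
      obtain rfl := (Sym2.mem_and_mem_iff hne).1 ⟨hu, hw⟩
      refine ⟨s(⟨u, hu'⟩, ⟨w, hw'⟩), ⟨he, ⟨u, hu'⟩, by simp, ⟨w, hw'⟩, by simp, ?_⟩, rfl⟩
      intro h
      exact huw (by rw [hf u hu', hf w hw', h])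
  calc _ ≤ k * (Set.range f).ncard := Nat.mul_le_mul_left k hrange
    _ ≤ _ := hG.mul_ncard_range_le f
    _ ≤ _ := Nat.add_le_add_right hedge k

theorem stmt15 {V : Type*} [Fintype V] (m k : ℕ) (hm : 0 < m) (hk : m ≤ k)
    (G : SimpleGraph V) (htc : IsTreeConn k G) (S : Finset V) :
    (Omega m (G.induce ((↑S : Set V)ᶜ)) : ℚ) ≤
      (∑ v ∈ S, ((m : ℚ) * (((G.neighborSet v).ncard : ℚ) - m) / k - m)) + m +
        (m : ℚ) / k * (Omega m (G.induce (↑S : Set V)) : ℚ) := by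
  have hpart := htc.mul_components_le m S
  have hdeg := ncard_edges_meeting_add_le_sum_degree G S
  have hsparse := mul_card_add_crossE_le m (G.induce (↑S : Set V))
  have hcard : Nat.card ↥(↑S : Set V) = S.card := by simp
  rw [hcard] at hsparse
  have hk0 : (0 : ℚ) < k := by exact_mod_cast hm.trans_le hk
  have hsum : ∑ v ∈ S, ((m : ℚ) * (((G.neighborSet v).ncard : ℚ) - m) / k - m) =
      m / k * ((∑ v ∈ S, (G.neighborSet v).ncard : ℕ) - m * S.card) - m * S.card := by
    rw [Finset.sum_sub_distrib, ← Finset.sum_div, ← Finset.mul_sum, Finset.sum_sub_distrib]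
    simp
    ring
  rw [hsum]
  unfold Omega
  generalize (∑ v ∈ S, (G.neighborSet v).ncard) = D at *
  generalize {e ∈ G.edgeSet | ∃ v ∈ e, v ∈ S}.ncard = t at *
  generalize (G.induce (S : Set V)).edgeSet.ncard = eS at *
  generalize crossE m (G.induce (S : Set V)) = c at *
  generalize crossE m (G.induce ((S : Set V)ᶜ)) = d at *
  generalize (Set.range (mComp m (G.induce (S : Set V)))).ncard = q at *
  generalize (Set.range (mComp m (G.induce ((S : Set V)ᶜ)))).ncard = p at *
  generalize S.card = s at *
  have hpart' : (k : ℚ) * (p + s) ≤ d + t + k := by exact_mod_cast hpart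
  have hdeg' : (t : ℚ) + eS ≤ D := by exact_mod_cast hdeg
  have hsparse' : (m : ℚ) * s + c ≤ eS + m * q := by exact_mod_cast hsparse
  have hmk : (m : ℚ) ≤ k := by exact_mod_cast hk
  have h1 : (m : ℚ) * (k * (p + s)) ≤ m * (d + (D - (m * s + c - m * q)) + k) := by
    gcongr
    linarith
  have h2 : (m : ℚ) * d ≤ k * d := by gcongr
  push_cast
  rw [← sub_nonneg]
  have key : (m : ℚ) / k * (D - m * s) - m * s + m + m / k * (m * q - c) - (m * p - d) =
      (m * (D - m * s) - k * m * s + k * m + m * (m * q - c) - k * (m * p - d)) / k := by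
    field_simp
  rw [key]
  apply div_nonneg _ hk0.le
  linarith
end
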